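/- There exist a differentiable function Φ₁ : ℝ → ℝ and constants c_φ > 0 and C_φ > 0 such that for all x ∈ ℝ: Φ₁'(x) = −φ(x), Φ₁(x) ≥ 1, and c_φ |x|^{λ+1} ≤ Φ₁(x) ≤ C_φ ( |x|^{λ+1} + 1 ). (Remark 2.2 of the paper.) -/

import Mathlib

theorem half_bound (F f : ℝ → ℝ) (lam a₂ a₃ : ℝ) (hlam : 1 ≤ lam) (ha₂ : 0 < a₂)
    (hF : ∀ x, HasDerivAt F (f x) x)
    (hf : ∀ x, a₂ * |x| ^ (lam + 1) - a₃ ≤ x * f x) :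
    ∃ M : ℝ, 0 ≤ M ∧ ∀ x, 0 ≤ x → a₂ / (2 * (lam + 1)) * x ^ (lam + 1) ≤ F x + M := by
  set c := a₂ / (2 * (lam + 1)) with hc
  have hp : 0 < lam + 1 := by linarith
  have hG : ∀ x, HasDerivAt (fun x => F x - c * x ^ (lam + 1)) (f x - a₂ / 2 * x ^ lam) x := by
    intro x
    have h1 := (Real.hasDerivAt_rpow_const (x := x) (p := lam + 1) (Or.inr (by linarith))).const_mul c
    have h2 := (hF x).sub h1
    have h3 : f x - c * ((lam + 1) * x ^ (lam + 1 - 1)) = f x - a₂ / 2 * x ^ lam := by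
      rw [hc, add_sub_cancel_right]
      field_simp
    rw [h3] at h2
    exact h2
  set G : ℝ → ℝ := fun x => F x - c * x ^ (lam + 1) with hGdef
  have hcont : Continuous G := continuous_iff_continuousAt.2 fun x => (hG x).continuousAt
  set R : ℝ := max 1 (2 * a₃ / a₂) with hR
  have hR1 : 1 ≤ R := le_max_left _ _
  have hR2 : 2 * a₃ / a₂ ≤ R := le_max_right _ _
  have hmono : MonotoneOn G (Set.Ici R) := by
    apply monotoneOn_of_deriv_nonneg (convex_Ici R) hcont.continuousOn
    · intro x _
      exact (hG x).differentiableAt.differentiableWithinAt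
    · intro x hx
      rw [interior_Ici] at hx
      have hx : R < x := hx
      rw [(hG x).deriv]
      have hx0 : 0 < x := by linarith
      have h1 := hf x
      rw [abs_of_pos hx0] at h1
      have h2 : x ^ (lam + 1) = x ^ lam * x := by
        rw [Real.rpow_add hx0, Real.rpow_one]
      have h3 : x ≤ x ^ (lam + 1) := by
        have := Real.rpow_le_rpow_of_exponent_le (x := x) (y := 1) (z := lam + 1)
          (by linarith) (by linarith)
        rwa [Real.rpow_one] at this
      have h4 : 2 * a₃ ≤ x * a₂ := by
        rw [← div_le_iff₀ ha₂]; linarith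
      have h5 : 0 ≤ x * (f x - a₂ / 2 * x ^ lam) := by
        have : x * a₂ ≤ x ^ (lam + 1) * a₂ := by gcongr
        have h6 : x * (f x - a₂ / 2 * x ^ lam) = x * f x - a₂ / 2 * x ^ (lam + 1) := by
          rw [h2]; ring
        rw [h6]; linarith
      exact nonneg_of_mul_nonneg_right h5 hx0
  obtain ⟨y, hy, hmin⟩ := (isCompact_Icc (a := (0 : ℝ)) (b := R)).exists_isMinOn
    ⟨0, by constructor <;> linarith⟩ hcont.continuousOn
  have hlow : ∀ x, 0 ≤ x → G y ≤ G x := by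
    intro x hx
    rcases le_total x R with h | h
    · exact hmin ⟨hx, h⟩
    · exact le_trans (hmin (show R ∈ Set.Icc 0 R from ⟨by linarith, le_refl _⟩))
        (hmono (Set.mem_Ici.2 le_rfl) (Set.mem_Ici.2 h) h)
  refine ⟨|G y|, abs_nonneg _, fun x hx => ?_⟩
  have h1 : G y ≤ F x - c * x ^ (lam + 1) := hlow x hx
  have h2 := neg_abs_le (G y)
  linarith

theorem stmt_7 (φ : ℝ → ℝ) (lam a₁ a₂ a₃ : ℝ)
    (hφ : ContDiff ℝ 1 φ) (hφ0 : φ 0 = 0)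
    (hlam : 1 ≤ lam) (hlam2 : lam < 2)
    (ha₁ : 0 < a₁) (ha₂ : 0 < a₂) (ha₃ : 0 < a₃)
    (hgrowth : ∀ x : ℝ, |φ x| ≤ a₁ * (1 + |x| ^ lam))
    (hdiss : ∀ x : ℝ, x * φ x ≤ -a₂ * |x| ^ (lam + 1) + a₃) :
    ∃ (Φ₁ : ℝ → ℝ) (cφ Cφ : ℝ), 0 < cφ ∧ 0 < Cφ ∧
      ∀ x : ℝ, HasDerivAt Φ₁ (-φ x) x ∧ 1 ≤ Φ₁ x ∧
        cφ * |x| ^ (lam + 1) ≤ Φ₁ x ∧ Φ₁ x ≤ Cφ * (|x| ^ (lam + 1) + 1) := by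
  have hcont : Continuous φ := hφ.continuous
  set F : ℝ → ℝ := fun x => ∫ t in (0 : ℝ)..x, -φ t with hFdef
  have hF : ∀ x, HasDerivAt F (-φ x) x := fun x =>
    (hcont.neg).integral_hasStrictDerivAt 0 x |>.hasDerivAt
  obtain ⟨M, hM0, hM⟩ := half_bound F (fun x => -φ x) lam a₂ a₃ hlam ha₂ hF
    (fun x => by have := hdiss x; linarith)
  obtain ⟨N, hN0, hN⟩ := half_bound (fun x => F (-x)) (fun x => φ (-x)) lam a₂ a₃ hlam ha₂
    (fun x => by
      have := (hF (-x)).comp x (hasDerivAt_neg x)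
      simpa [Function.comp_def] using this)
    (fun x => by have := hdiss (-x); rw [abs_neg] at this; linarith)
  have hp : 0 < lam + 1 := by linarith
  have hc : 0 < a₂ / (2 * (lam + 1)) := by positivity
  refine ⟨fun x => F x + (M + N + 1), a₂ / (2 * (lam + 1)), 2 * a₁ + (M + N + 1), hc,
    by positivity, fun x => ?_⟩
  have hlow : a₂ / (2 * (lam + 1)) * |x| ^ (lam + 1) ≤ F x + (M + N) := by
    rcases le_total 0 x with h | h
    · have := hM x h
      rw [abs_of_nonneg h]; linarith
    · have := hN (-x) (by linarith)
      simp only [neg_neg] at this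
      rw [abs_of_nonpos h]; linarith
  have hpow : 0 ≤ |x| ^ (lam + 1) := by positivity
  have hpos := mul_nonneg hc.le hpow
  have hup : F x ≤ 2 * a₁ * (|x| ^ (lam + 1) + 1) := by
    have h1 : ‖F x‖ ≤ a₁ * (1 + |x| ^ lam) * |x - 0| := by
      apply intervalIntegral.norm_integral_le_of_norm_le_const
      intro t ht
      rw [norm_neg, Real.norm_eq_abs]
      have htx : |t| ≤ |x| := by
        rcases Set.mem_uIoc.1 ht with h | h
        · rw [abs_of_pos h.1]; exact h.2.trans (le_abs_self x)
        · rw [abs_of_nonpos h.2, abs_of_neg (h.1.trans_le h.2)]; linarith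
      refine (hgrowth t).trans ?_
      gcongr
    rw [sub_zero, Real.norm_eq_abs] at h1
    have h2 : |x| ^ (lam + 1) = |x| ^ lam * |x| := by
      rw [Real.rpow_add_one' (abs_nonneg x) hp.ne']
    have h3 : |x| ≤ |x| ^ (lam + 1) + 1 := by
      rcases le_total |x| 1 with h | h
      · linarith
      · have := Real.rpow_le_rpow_of_exponent_le (x := |x|) (y := 1) (z := lam + 1)
          h (by linarith)
        rw [Real.rpow_one] at this
        linarith
    have h4 : a₁ * (1 + |x| ^ lam) * |x| = a₁ * (|x| + |x| ^ (lam + 1)) := by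
      rw [h2]; ring
    have h5 : a₁ * (|x| + |x| ^ (lam + 1)) ≤ a₁ * (2 * (|x| ^ (lam + 1) + 1)) := by
      gcongr; linarith
    have := le_abs_self (F x)
    linarith
  refine ⟨(hF x).add_const _, ?_, ?_, ?_⟩
  · show 1 ≤ F x + (M + N + 1)
    linarith
  · show _ ≤ F x + (M + N + 1)
    linarith
  · show F x + (M + N + 1) ≤ _
    have : 0 ≤ (M + N + 1) * |x| ^ (lam + 1) := by positivity
    linarith
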